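/- arXiv:1707.06804 — 2 statements merged into one kernel-verified Lean document; each statement's English description precedes it below -/
import Mathlib

section
/- Let n ≥ 3. The trace-free symmetric gradient operator ℰ^D is ℂ-elliptic: for every ξ ∈ ℂ^n \ {0} and η ∈ ℂ^n, if (1/2)(η_j ξ_k + η_k ξ_j) − (1/n) δ_{jk} (∑_{l=1}^n ξ_l η_l) = 0 for all j, k ∈ {1,…,n}, then η = 0. -/
/-- The complexified symbol of the trace-free symmetric gradient `ℰ^D` at
`ξ ∈ ℂ^n` applied to `η ∈ ℂ^n`: the `(j,k)`-entry is
`(1/2)(η_j ξ_k + η_k ξ_j) − (1/n)δ_{jk} ∑_l ξ_l η_l`. -/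
noncomputable def EDsymbol (n : ℕ) (ξ η : Fin n → ℂ) : Matrix (Fin n) (Fin n) ℂ :=
  fun j k => (1 / 2) * (η j * ξ k + η k * ξ j) -
    (1 / (n : ℂ)) * (if j = k then 1 else 0) * ∑ l, ξ l * η l

/-- for `n ≥ 3` the trace-free symmetric gradient is `ℂ`-elliptic. -/
theorem statement13 (n : ℕ) (hn : 3 ≤ n) :
    ∀ ξ : Fin n → ℂ, ξ ≠ 0 → ∀ η : Fin n → ℂ,
      (∀ j k, EDsymbol n ξ η j k = 0) → η = 0 := by
  intro ξ hξ η h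
  obtain ⟨s, hs⟩ : ∃ s, ∀ j, η j * ξ j = s :=
    ⟨1 / (n : ℂ) * ∑ l, ξ l * η l, fun j => by
      have := h j j
      simp only [EDsymbol, if_true] at this
      linear_combination this⟩
  have hoff : ∀ j k, j ≠ k → η j * ξ k + η k * ξ j = 0 := fun j k hjk => by
    have := h j k
    simp only [EDsymbol, if_neg hjk] at this
    linear_combination 2 * this
  have hs0 : s = 0 := by
    let a : Fin n := ⟨0, by omega⟩
    let b : Fin n := ⟨1, by omega⟩
    let c : Fin n := ⟨2, by omega⟩
    have hab := hoff a b (by simp [a, b])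
    have hbc := hoff b c (by simp [b, c])
    have hac := hoff a c (by simp [a, c])
    have hprod : s * (η a * ξ c) = 0 := by
      linear_combination (1 / 2) * (η b * ξ c * hab - η b * ξ a * hbc + s * hac
        + (η c * ξ a - η a * ξ c) * hs b)
    have hcube : s ^ 3 = 0 := by
      linear_combination η c * ξ a * hprod - s * η c * ξ c * hs a - s * s * hs c
    exact pow_eq_zero_iff (by norm_num) |>.mp hcube
  obtain ⟨k, hk⟩ := Function.ne_iff.mp hξ
  have hηk : η k = 0 := (mul_eq_zero.mp ((hs k).trans hs0)).resolve_right hk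
  funext j
  by_cases hjk : j = k
  · rw [hjk, hηk, Pi.zero_apply]
  · have := hoff j k hjk
    rw [hηk, zero_mul, add_zero] at this
    exact (mul_eq_zero.mp this).resolve_right hk
end

section
/- Consider the first-order constant-coefficient operator 𝔸 acting on maps u : ℝ³ → ℝ², with values in 2×3 matrices, defined by 𝔸(u) := [[ (1/2)∂₁u₁ − (1/2)∂₂u₂ , (1/2)∂₁u₂ + (1/2)∂₂u₁ , ∂₃u₁ ], [ (1/2)∂₁u₂ + (1/2)∂₂u₁ , (1/2)∂₁u₁ − (1/2)∂₂u₂ , ∂₃u₂ ]]. Then 𝔸 is ℝ-elliptic (for every ξ ∈ ℝ³ \ {0} and η ∈ ℝ², the vanishing of all symbol entries (1/2)(ξ₁η₁ − ξ₂η₂), (1/2)(ξ₁η₂ + ξ₂η₁), ξ₃η₁, ξ₃η₂ forces η = 0), but 𝔸 is not ℂ-elliptic: for ξ = (1, i, 0) ∈ ℂ³ \ {0} and η = (1, −i) ∈ ℂ² \ {0}, all entries of the complexified symbol vanish. -/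
/-- The symbol of the operator
`𝔸(u) = [[½∂₁u₁−½∂₂u₂, ½∂₁u₂+½∂₂u₁, ∂₃u₁], [½∂₁u₂+½∂₂u₁, ½∂₁u₁−½∂₂u₂, ∂₃u₂]]`
(acting on maps `ℝ³ → ℝ²` with 2×3-matrix values) at `ξ` applied to `η`,
over any field. -/
noncomputable def exSymbol {R : Type*} [Field R] (ξ : Fin 3 → R) (η : Fin 2 → R) :
    Matrix (Fin 2) (Fin 3) R :=
  ![![(1 / 2) * (ξ 0 * η 0 - ξ 1 * η 1), (1 / 2) * (ξ 0 * η 1 + ξ 1 * η 0), ξ 2 * η 0],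
    ![(1 / 2) * (ξ 0 * η 1 + ξ 1 * η 0), (1 / 2) * (ξ 0 * η 0 - ξ 1 * η 1), ξ 2 * η 1]]

/-- the above operator is `ℝ`-elliptic but not `ℂ`-elliptic: its
complexified symbol vanishes at `ξ = (1, i, 0) ≠ 0`, `η = (1, −i) ≠ 0`. -/
theorem statement17 :
    (∀ ξ : Fin 3 → ℝ, ξ ≠ 0 → ∀ η : Fin 2 → ℝ,
        (∀ i j, exSymbol ξ η i j = 0) → η = 0) ∧
    ((![1, Complex.I, 0] : Fin 3 → ℂ) ≠ 0 ∧ (![1, -Complex.I] : Fin 2 → ℂ) ≠ 0 ∧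
      ∀ i j, exSymbol ![1, Complex.I, 0] ![1, -Complex.I] i j = 0) := by
  refine ⟨fun ξ hξ η h => ?_, ?_, ?_, ?_⟩
  · have ha : (1 / 2) * (ξ 0 * η 0 - ξ 1 * η 1) = 0 := h 0 0
    have hb : (1 / 2) * (ξ 0 * η 1 + ξ 1 * η 0) = 0 := h 0 1
    have hc : ξ 2 * η 0 = 0 := h 0 2
    have hd : ξ 2 * η 1 = 0 := h 1 2
    have hpos : ξ 0 ^ 2 + ξ 1 ^ 2 + ξ 2 ^ 2 ≠ 0 := by
      contrapose! hξ
      ext i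
      rw [← Fin.sum_univ_three (fun i => ξ i ^ 2),
        Finset.sum_eq_zero_iff_of_nonneg fun i _ => sq_nonneg (ξ i)] at hξ
      exact (pow_eq_zero_iff two_ne_zero).1 (hξ i (Finset.mem_univ i))
    have h0 : (ξ 0 ^ 2 + ξ 1 ^ 2 + ξ 2 ^ 2) * η 0 = 0 := by
      linear_combination 2 * ξ 0 * ha + 2 * ξ 1 * hb + ξ 2 * hc
    have h1 : (ξ 0 ^ 2 + ξ 1 ^ 2 + ξ 2 ^ 2) * η 1 = 0 := by
      linear_combination 2 * ξ 0 * hb - 2 * ξ 1 * ha + ξ 2 * hd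
    ext i
    fin_cases i
    · exact (mul_eq_zero.1 h0).resolve_left hpos
    · exact (mul_eq_zero.1 h1).resolve_left hpos
  · exact fun h => one_ne_zero (congrFun h 0)
  · exact fun h => one_ne_zero (congrFun h 0)
  · intro i j
    fin_cases i <;> fin_cases j <;> simp [exSymbol]
end
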